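/- Fix 0 < M ≤ 1/8 and p ∈ (0,4), and let α : D → ℝ be a smooth solution of ∂_u(r⁻⁴·Ω⁴·∂_v(r⁵·α)) = −(30M·Ω⁶/r⁷)·r⁵·α on D. Assume K := sup_{(u,v)∈D} r(u,v)^p·|α(u,v)| < ∞, and that for every v ≥ 1 one has (r⁻⁴·Ω⁴·∂_v(r⁵·α))(u,v) → 0 as u → −∞. Then there is a constant C, depending only on p, such that for all (u,v) ∈ D: |r(u,v)⁵·α(u,v) − r(u,1)⁵·α(u,1)| ≤ C·K·M·r(u,v)^{4−p}. (In particular any global decay estimate |α| ≤ K r^{−p} can be iteratively improved to |α| ≲ r⁻⁵·(data) + r^{−p−1}.) -/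

import Mathlib

noncomputable section
open Real Set Filter

/-- The domain `D = {(u,v) : u ≤ -1, v ≥ 1}`. -/
def D : Set (ℝ × ℝ) := {p | p.1 ≤ -1 ∧ 1 ≤ p.2}

/-- `Ω² = 1 - 2M/r`. -/
def Om2 (M : ℝ) (r : ℝ → ℝ → ℝ) (u v : ℝ) : ℝ := 1 - 2 * M / r u v

/-- `r` is the Schwarzschild area radius in double null coordinates on `D`:
smooth, `> 2M`, satisfying `r + 2M log(r/(2M)-1) = v - u` and
`∂_v r = 1 - 2M/r = -∂_u r`. -/
structure IsSchwR (M : ℝ) (r : ℝ → ℝ → ℝ) : Prop where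
  smooth : ContDiffOn ℝ (⊤ : ℕ∞) (fun p : ℝ × ℝ => r p.1 p.2) D
  gt2M : ∀ u v : ℝ, (u, v) ∈ D → 2 * M < r u v
  eqn : ∀ u v : ℝ, (u, v) ∈ D →
    r u v + 2 * M * Real.log (r u v / (2 * M) - 1) = v - u
  dv : ∀ u v : ℝ, (u, v) ∈ D →
    deriv (fun v' => r u v') v = 1 - 2 * M / r u v
  du : ∀ u v : ℝ, (u, v) ∈ D →
    deriv (fun u' => r u' v) u = -(1 - 2 * M / r u v)

open scoped Topology

/-- A function vanishing at `-∞` whose derivative is dominated by that of another function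
vanishing at `-∞` is dominated by that function. -/
lemma abs_le_of_abs_deriv_le_atBot {f g f' g' : ℝ → ℝ} {a : ℝ}
    (hf : ∀ x < a, HasDerivAt f (f' x) x) (hg : ∀ x < a, HasDerivAt g (g' x) x)
    (hle : ∀ x < a, |f' x| ≤ g' x)
    (hf0 : Tendsto f atBot (𝓝 0)) (hg0 : Tendsto g atBot (𝓝 0)) {x : ℝ} (hx : x < a) :
    |f x| ≤ g x := by
  have key : ∀ s : ℝ, |s| ≤ 1 → s * f x ≤ g x := by
    intro s hs
    have hd : ∀ y < a, HasDerivAt (fun y => g y - s * f y) (g' y - s * f' y) y :=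
      fun y hy => (hg y hy).sub ((hf y hy).const_mul s)
    have hmono : MonotoneOn (fun y => g y - s * f y) (Iio a) := by
      refine monotoneOn_of_deriv_nonneg (convex_Iio a)
        (fun y hy => (hd y hy).continuousAt.continuousWithinAt)
        (fun y hy => (hd y (interior_subset hy : y ∈ Iio a)).differentiableAt.differentiableWithinAt) ?_
      intro y hy
      have hy' : y < a := (interior_subset hy : y ∈ Iio a)
      rw [(hd y hy').deriv]
      have h1 : s * f' y ≤ |s| * |f' y| := by rw [← abs_mul]; exact le_abs_self _
      nlinarith [hle y hy', abs_nonneg (f' y)]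
    have hlim : Tendsto (fun y => g y - s * f y) atBot (𝓝 0) := by
      simpa using hg0.sub (hf0.const_mul s)
    have h0 : 0 ≤ g x - s * f x := by
      refine le_of_tendsto hlim ?_
      filter_upwards [eventually_le_atBot x] with y hy
      exact hmono (lt_of_le_of_lt hy hx) hx hy
    linarith
  rw [abs_le]
  constructor
  · have := key (-1) (by norm_num)
    linarith
  · have := key 1 (by norm_num)
    linarith

/-- Mean value inequality in comparison form. -/
lemma abs_sub_le_of_abs_deriv_le {f g f' g' : ℝ → ℝ} {a b : ℝ} (hab : a ≤ b)
    (hfc : ContinuousOn f (Icc a b)) (hgc : ContinuousOn g (Icc a b))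
    (hf : ∀ x ∈ Ioo a b, HasDerivAt f (f' x) x) (hg : ∀ x ∈ Ioo a b, HasDerivAt g (g' x) x)
    (hle : ∀ x ∈ Ioo a b, |f' x| ≤ g' x) :
    |f b - f a| ≤ g b - g a := by
  have key : ∀ s : ℝ, |s| ≤ 1 → s * (f b - f a) ≤ g b - g a := by
    intro s hs
    have hd : ∀ y ∈ Ioo a b, HasDerivAt (fun y => g y - s * f y) (g' y - s * f' y) y :=
      fun y hy => (hg y hy).sub ((hf y hy).const_mul s)
    have hmono : MonotoneOn (fun y => g y - s * f y) (Icc a b) := by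
      refine monotoneOn_of_deriv_nonneg (convex_Icc a b)
        (hgc.sub (continuousOn_const.mul hfc)) ?_ ?_
      · rw [interior_Icc]
        exact fun y hy => (hd y hy).differentiableAt.differentiableWithinAt
      · rw [interior_Icc]
        intro y hy
        rw [(hd y hy).deriv]
        have h1 : s * f' y ≤ |s| * |f' y| := by rw [← abs_mul]; exact le_abs_self _
        nlinarith [hle y hy, abs_nonneg (f' y)]
    have h0 := hmono (left_mem_Icc.2 hab) (right_mem_Icc.2 hab) hab
    simp only at h0
    linarith
  rw [abs_le]
  constructor
  · have := key (-1) (by norm_num)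
    linarith
  · have := key 1 (by norm_num)
    linarith

lemma D_mem_nhds {u v : ℝ} (hu : u < -1) (hv : 1 < v) : D ∈ 𝓝 (u, v) := by
  have h : Iic (-1 : ℝ) ×ˢ Ici (1 : ℝ) ∈ 𝓝 (u, v) :=
    prod_mem_nhds (Iic_mem_nhds hu) (Ici_mem_nhds hv)
  exact h

/-- The partial derivative in the second variable of a smooth function of two variables is
differentiable in the first variable. -/
lemma differentiableAt_deriv_snd {G : ℝ × ℝ → ℝ} {u v : ℝ} (hG : ContDiffAt ℝ 2 G (u, v)) :
    DifferentiableAt ℝ (fun u' => deriv (fun v' => G (u', v')) v) u := by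
  have hline : DifferentiableAt ℝ (fun u' : ℝ => (u', v)) u := by fun_prop
  have h2 : DifferentiableAt ℝ (fderiv ℝ G) (u, v) :=
    (hG.fderiv_right (m := 1) (by norm_num)).differentiableAt (by norm_num)
  have h3 : DifferentiableAt ℝ (fun u' => fderiv ℝ G (u', v) (0, 1)) u :=
    (DifferentiableAt.comp (g := fderiv ℝ G) u h2 hline).clm_apply (differentiableAt_const _)
  have hev : ∀ᶠ u' in 𝓝 u, ContDiffAt ℝ 2 G (u', v) :=
    hline.continuousAt.eventually (hG.eventually (by simp))
  refine h3.congr_of_eventuallyEq ?_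
  filter_upwards [hev] with u' hu'
  have h4 : HasFDerivAt G (fderiv ℝ G (u', v)) (u', v) :=
    (hu'.differentiableAt (by norm_num)).hasFDerivAt
  have h5 : HasDerivAt (fun v' : ℝ => (u', v')) ((0 : ℝ), (1 : ℝ)) v :=
    (hasDerivAt_const v u').prodMk (hasDerivAt_id v)
  exact (h4.comp_hasDerivAt v h5).deriv

namespace IsSchwR

variable {M : ℝ} {r : ℝ → ℝ → ℝ}

lemma sub_le_two_mul (hr : IsSchwR M r) (hM : 0 < M) {u v : ℝ} (h : (u, v) ∈ D) :
    v - u + 4 * M ≤ 2 * r u v := by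
  have h1 := hr.gt2M u v h
  have hx : 0 < r u v / (2 * M) - 1 := by
    rw [sub_pos, lt_div_iff₀ (by positivity)]
    linarith
  have h2 := Real.log_le_sub_one_of_pos hx
  have h3 : 2 * M * Real.log (r u v / (2 * M) - 1) ≤ 2 * M * (r u v / (2 * M) - 1 - 1) :=
    mul_le_mul_of_nonneg_left h2 (by positivity)
  have h4 : 2 * M * (r u v / (2 * M) - 1 - 1) = r u v - 4 * M := by
    field_simp
    ring
  linarith [hr.eqn u v h]

lemma one_le (hr : IsSchwR M r) (hM : 0 < M) {u v : ℝ} (h : (u, v) ∈ D) : 1 ≤ r u v := by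
  have h1 := hr.sub_le_two_mul hM h
  have h2 : u ≤ -1 := h.1
  have h3 : 1 ≤ v := h.2
  linarith

lemma three_quarters_le_Om2 (hr : IsSchwR M r) (hM : 0 < M) (hM8 : M ≤ 1 / 8) {u v : ℝ}
    (h : (u, v) ∈ D) : 3 / 4 ≤ Om2 M r u v := by
  have h1 := hr.one_le hM h
  have h2 : 2 * M / r u v ≤ 1 / 4 := by
    rw [div_le_iff₀ (by linarith)]
    linarith
  unfold Om2
  linarith

lemma Om2_le_one (hr : IsSchwR M r) (hM : 0 < M) {u v : ℝ} (h : (u, v) ∈ D) :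
    Om2 M r u v ≤ 1 := by
  have h1 := hr.one_le hM h
  have h2 : 0 ≤ 2 * M / r u v := by positivity
  unfold Om2
  linarith

lemma hasDerivAt_fst (hr : IsSchwR M r) (hM : 0 < M) (hM8 : M ≤ 1 / 8) {u v : ℝ}
    (h : (u, v) ∈ D) : HasDerivAt (fun u' => r u' v) (-Om2 M r u v) u := by
  have h1 := hr.three_quarters_le_Om2 hM hM8 h
  have h2 : deriv (fun u' => r u' v) u = -Om2 M r u v := hr.du u v h
  rw [← h2]
  exact (differentiableAt_of_deriv_ne_zero (by rw [h2]; linarith)).hasDerivAt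

lemma hasDerivAt_snd (hr : IsSchwR M r) (hM : 0 < M) (hM8 : M ≤ 1 / 8) {u v : ℝ}
    (h : (u, v) ∈ D) : HasDerivAt (fun v' => r u v') (Om2 M r u v) v := by
  have h1 := hr.three_quarters_le_Om2 hM hM8 h
  have h2 : deriv (fun v' => r u v') v = Om2 M r u v := hr.dv u v h
  rw [← h2]
  exact (differentiableAt_of_deriv_ne_zero (by rw [h2]; linarith)).hasDerivAt

lemma tendsto_atBot (hr : IsSchwR M r) (hM : 0 < M) {v : ℝ} (hv : 1 ≤ v) :
    Tendsto (fun u => r u v) atBot atTop := by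
  have h1 : Tendsto (fun u : ℝ => (-u) * (1 / 2)) atBot atTop :=
    tendsto_neg_atBot_atTop.atTop_mul_const (by norm_num)
  refine tendsto_atTop_mono' _ ?_ h1
  filter_upwards [eventually_le_atBot (-1 : ℝ)] with u hu
  have := hr.sub_le_two_mul hM (u := u) (v := v) ⟨hu, hv⟩
  linarith

end IsSchwR

/-- Integrating the Teukolsky equation from past null infinity. -/
lemma abs_weighted_deriv_le {p M K : ℝ} {r α : ℝ → ℝ → ℝ} (hp0 : 0 < p) (hM : 0 < M)
    (hM8 : M ≤ 1 / 8) (hr : IsSchwR M r)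
    (hα : ContDiffOn ℝ (⊤ : ℕ∞) (fun q : ℝ × ℝ => α q.1 q.2) D)
    (heq : ∀ u v : ℝ, (u, v) ∈ D →
      deriv (fun u' => (r u' v) ^ (-4 : ℤ) * (Om2 M r u' v) ^ 2 *
          deriv (fun v' => (r u' v') ^ 5 * α u' v') v) u
        = -(30 * M * (Om2 M r u v) ^ 3 / (r u v) ^ 7) * ((r u v) ^ 5 * α u v))
    (hK : ∀ u v : ℝ, (u, v) ∈ D → (r u v) ^ p * |α u v| ≤ K)
    (hlim : ∀ v : ℝ, 1 ≤ v →
      Tendsto (fun u => (r u v) ^ (-4 : ℤ) * (Om2 M r u v) ^ 2 *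
          deriv (fun v' => (r u v') ^ 5 * α u v') v) atBot (𝓝 0))
    {u v : ℝ} (hu : u < -1) (hv : 1 < v) :
    |(r u v) ^ (-4 : ℤ) * (Om2 M r u v) ^ 2 * deriv (fun v' => (r u v') ^ 5 * α u v') v|
      ≤ 30 * M * K / (1 + p) * (r u v) ^ (-(1 + p)) := by
  have hmem : ∀ x < -1, (x, v) ∈ D := fun x hx => ⟨hx.le, hv.le⟩
  refine abs_le_of_abs_deriv_le_atBot (a := -1)
    (f := fun u => (r u v) ^ (-4 : ℤ) * (Om2 M r u v) ^ 2 *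
      deriv (fun v' => (r u v') ^ 5 * α u v') v)
    (g := fun u => 30 * M * K / (1 + p) * (r u v) ^ (-(1 + p)))
    (f' := fun u => -(30 * M * (Om2 M r u v) ^ 3 / (r u v) ^ 7) * ((r u v) ^ 5 * α u v))
    (g' := fun u => 30 * M * K / (1 + p) *
      ((-Om2 M r u v) * (-(1 + p)) * (r u v) ^ (-(1 + p) - 1)))
    ?_ ?_ ?_ (hlim v hv.le) ?_ hu
  · intro x hx
    rw [← heq x v (hmem x hx)]
    refine DifferentiableAt.hasDerivAt ?_
    have hr1 := hr.one_le hM (hmem x hx)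
    have hr0 : r x v ≠ 0 := by linarith
    have hrd := (hr.hasDerivAt_fst hM hM8 (hmem x hx)).differentiableAt
    have hG : ContDiffAt ℝ 2 (fun q : ℝ × ℝ => (r q.1 q.2) ^ 5 * α q.1 q.2) (x, v) := by
      have hn := D_mem_nhds hx hv
      have h1 := (hr.smooth.contDiffAt hn).of_le (m := 2) (WithTop.coe_le_coe.2 le_top)
      have h2 := (hα.contDiffAt hn).of_le (m := 2) (WithTop.coe_le_coe.2 le_top)
      exact (h1.pow 5).mul h2
    refine DifferentiableAt.mul (DifferentiableAt.mul ?_ ?_) (differentiableAt_deriv_snd hG)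
    · exact hrd.zpow (Or.inl hr0)
    · unfold Om2
      exact ((differentiableAt_const _).sub ((differentiableAt_const _).div hrd hr0)).pow 2
  · intro x hx
    have hr1 := hr.one_le hM (hmem x hx)
    exact ((hr.hasDerivAt_fst hM hM8 (hmem x hx)).rpow_const (Or.inl (by linarith))).const_mul _
  · intro x hx
    have hr1 := hr.one_le hM (hmem x hx)
    have hr0 : 0 < r x v := by linarith
    have hO := hr.three_quarters_le_Om2 hM hM8 (hmem x hx)
    have hO1 := hr.Om2_le_one hM (hmem x hx)
    have hKx := hK x v (hmem x hx)
    generalize Om2 M r x v = O at *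
    generalize r x v = y at *
    generalize α x v = a at *
    have hO0 : 0 < O := by linarith
    have hy : y ^ (-(1 + p) - 1) = (y ^ p)⁻¹ * (y ^ 2)⁻¹ := by
      rw [show -(1 + p) - 1 = -p + -2 by ring, rpow_add hr0, rpow_neg hr0.le, rpow_neg hr0.le]
      norm_num
    have hyp : 0 < y ^ p := rpow_pos_of_pos hr0 p
    have ha : |a| ≤ K * (y ^ p)⁻¹ := by
      rw [← div_eq_mul_inv, le_div_iff₀ hyp]
      linarith
    have hO3 : O ^ 3 ≤ O := by
      nlinarith [mul_nonneg hO0.le (by nlinarith : (0 : ℝ) ≤ 1 - O ^ 2)]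
    have e1 : |-(30 * M * O ^ 3 / y ^ 7) * (y ^ 5 * a)| = 30 * M * (y ^ 2)⁻¹ * (O ^ 3 * |a|) := by
      rw [abs_mul, abs_neg, abs_mul, abs_of_nonneg (by positivity : 0 ≤ 30 * M * O ^ 3 / y ^ 7),
        abs_of_nonneg (by positivity : 0 ≤ y ^ 5)]
      field_simp
    have e2 : 30 * M * K / (1 + p) * (-O * (-(1 + p)) * y ^ (-(1 + p) - 1))
        = 30 * M * (y ^ 2)⁻¹ * (O * (K * (y ^ p)⁻¹)) := by
      rw [hy]
      field_simp
    rw [e1, e2]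
    gcongr
  · have h1 : Tendsto (fun y : ℝ => y ^ (-(1 + p))) atTop (𝓝 0) :=
      tendsto_rpow_neg_atTop (by linarith)
    simpa using (h1.comp (hr.tendsto_atBot hM hv.le)).const_mul (30 * M * K / (1 + p))

/-- The improved estimate away from the boundary line `u = -1`. -/
lemma bootstrap_improvement_of_lt {p M K : ℝ} {r α : ℝ → ℝ → ℝ} (hp0 : 0 < p) (hp4 : p < 4)
    (hM : 0 < M) (hM8 : M ≤ 1 / 8) (hr : IsSchwR M r)
    (hα : ContDiffOn ℝ (⊤ : ℕ∞) (fun q : ℝ × ℝ => α q.1 q.2) D)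
    (heq : ∀ u v : ℝ, (u, v) ∈ D →
      deriv (fun u' => (r u' v) ^ (-4 : ℤ) * (Om2 M r u' v) ^ 2 *
          deriv (fun v' => (r u' v') ^ 5 * α u' v') v) u
        = -(30 * M * (Om2 M r u v) ^ 3 / (r u v) ^ 7) * ((r u v) ^ 5 * α u v))
    (hK : ∀ u v : ℝ, (u, v) ∈ D → (r u v) ^ p * |α u v| ≤ K)
    (hlim : ∀ v : ℝ, 1 ≤ v →
      Tendsto (fun u => (r u v) ^ (-4 : ℤ) * (Om2 M r u v) ^ 2 *
          deriv (fun v' => (r u v') ^ 5 * α u v') v) atBot (𝓝 0))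
    {u v : ℝ} (hu : u < -1) (hv : 1 ≤ v) :
    |(r u v) ^ 5 * α u v - (r u 1) ^ 5 * α u 1|
      ≤ 120 / ((1 + p) * (4 - p)) * K * M * (r u v) ^ (4 - p) := by
  have h4p : 0 < 4 - p := by linarith
  have hmem : ∀ x, 1 ≤ x → (u, x) ∈ D := fun x hx => ⟨hu.le, hx⟩
  have hK0 : 0 ≤ K := by
    have := hr.one_le hM (hmem v hv)
    exact (by positivity : 0 ≤ (r u v) ^ p * |α u v|).trans (hK u v (hmem v hv))
  have hline : ContinuousOn (fun x : ℝ => (u, x)) (Icc 1 v) := by fun_prop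
  have hmaps : MapsTo (fun x : ℝ => (u, x)) (Icc 1 v) D := fun x hx => hmem x hx.1
  have hrc : ContinuousOn (fun x => r u x) (Icc 1 v) :=
    hr.smooth.continuousOn.comp hline hmaps
  have hαc : ContinuousOn (fun x => α u x) (Icc 1 v) := hα.continuousOn.comp hline hmaps
  set c := 120 / ((1 + p) * (4 - p)) * K * M with hc
  have hc0 : 0 ≤ c := by positivity
  have main := abs_sub_le_of_abs_deriv_le hv
    (f := fun x => (r u x) ^ 5 * α u x) (g := fun x => c * (r u x) ^ (4 - p))
    (f' := fun x => deriv (fun x => (r u x) ^ 5 * α u x) x)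
    (g' := fun x => c * (Om2 M r u x * (4 - p) * (r u x) ^ (4 - p - 1)))
    ((hrc.pow 5).mul hαc)
    (continuousOn_const.mul (hrc.rpow_const fun x _ => Or.inr h4p.le)) ?_ ?_ ?_
  · have h1 := hr.one_le hM (hmem 1 le_rfl)
    have h2 : 0 ≤ c * (r u 1) ^ (4 - p) := by positivity
    linarith
  · intro x hx
    have hαd : DifferentiableAt ℝ (fun x => α u x) x :=
      DifferentiableAt.comp (g := fun q : ℝ × ℝ => α q.1 q.2) x
        ((hα.contDiffAt (D_mem_nhds hu hx.1)).differentiableAt (by simp))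
        (by fun_prop : DifferentiableAt ℝ (fun x : ℝ => (u, x)) x)
    exact (((hr.hasDerivAt_snd hM hM8 (hmem x hx.1.le)).differentiableAt.pow 5).mul
      hαd).hasDerivAt
  · intro x hx
    have hr1 := hr.one_le hM (hmem x hx.1.le)
    exact ((hr.hasDerivAt_snd hM hM8 (hmem x hx.1.le)).rpow_const
      (Or.inl (by linarith))).const_mul _
  · intro x hx
    have hF := abs_weighted_deriv_le hp0 hM hM8 hr hα heq hK hlim hu hx.1
    have hr1 := hr.one_le hM (hmem x hx.1.le)
    have hO := hr.three_quarters_le_Om2 hM hM8 (hmem x hx.1.le)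
    generalize deriv (fun x => (r u x) ^ 5 * α u x) x = d at *
    generalize Om2 M r u x = O at *
    generalize r u x = y at *
    have hy : 0 < y := by linarith
    have hO0 : 0 < O := by linarith
    have e1 : |y ^ (-4 : ℤ) * O ^ 2 * d| = O ^ 2 * |d| / y ^ 4 := by
      rw [abs_mul, abs_of_nonneg (by positivity : 0 ≤ y ^ (-4 : ℤ) * O ^ 2), zpow_neg]
      norm_cast
      field_simp
    have e2 : y ^ (4 - p - 1) = y ^ (-(1 + p)) * y ^ 4 := by
      rw [show 4 - p - 1 = -(1 + p) + (4 : ℕ) by push_cast; ring, rpow_add hy, rpow_natCast]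
    rw [e1, div_le_iff₀ (by positivity), mul_assoc, ← e2] at hF
    have e3 : c * (O * (4 - p) * y ^ (4 - p - 1))
        = 4 * O * (30 * M * K / (1 + p) * y ^ (4 - p - 1)) := by
      rw [hc]
      field_simp
      ring
    rw [e3]
    have hO3 : 1 ≤ 4 * O * O ^ 2 := by
      have : (3 / 4 : ℝ) ^ 3 ≤ O ^ 3 := by gcongr
      nlinarith
    calc |d| ≤ (4 * O * O ^ 2) * |d| := le_mul_of_one_le_left (abs_nonneg d) hO3
      _ = 4 * O * (O ^ 2 * |d|) := by ring
      _ ≤ _ := by gcongr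

/-- Bootstrap lemma: if a smooth solution of the `ℓ = 2`, `s = +2` Teukolsky equation
satisfies the global bound `r^p|α| ≤ K` (`0 < p < 4`) and has no incoming radiation from
past null infinity, then `|r⁵α(u,v) − r₀⁵α(u,1)| ≤ C·K·M·r^{4−p}` on `D`, with `C`
depending only on `p`. -/
theorem bootstrap_improvement (p : ℝ) (hp0 : 0 < p) (hp4 : p < 4) :
    ∃ C : ℝ, 0 < C ∧
      ∀ (M : ℝ) (r α : ℝ → ℝ → ℝ) (K : ℝ), 0 < M → M ≤ 1 / 8 → IsSchwR M r →
        ContDiffOn ℝ (⊤ : ℕ∞) (fun q : ℝ × ℝ => α q.1 q.2) D →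
        (∀ u v : ℝ, (u, v) ∈ D →
          deriv (fun u' => (r u' v) ^ (-4 : ℤ) * (Om2 M r u' v) ^ 2 *
              deriv (fun v' => (r u' v') ^ 5 * α u' v') v) u
            = -(30 * M * (Om2 M r u v) ^ 3 / (r u v) ^ 7) * ((r u v) ^ 5 * α u v)) →
        (∀ u v : ℝ, (u, v) ∈ D → (r u v) ^ p * |α u v| ≤ K) →
        (∀ v : ℝ, 1 ≤ v →
          Tendsto (fun u => (r u v) ^ (-4 : ℤ) * (Om2 M r u v) ^ 2 *
              deriv (fun v' => (r u v') ^ 5 * α u v') v) atBot (nhds 0)) →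
        ∀ u v : ℝ, (u, v) ∈ D →
          |(r u v) ^ 5 * α u v - (r u 1) ^ 5 * α u 1| ≤ C * K * M * (r u v) ^ (4 - p) := by
  have h4p : 0 < 4 - p := by linarith
  refine ⟨120 / ((1 + p) * (4 - p)), by positivity, ?_⟩
  intro M r α K hM hM8 hr hα heq hK hlim u v huv
  have hv : 1 ≤ v := huv.2
  have hslice : ∀ {f : ℝ × ℝ → ℝ}, ContinuousOn f D → ∀ w : ℝ, 1 ≤ w →
      ContinuousWithinAt (fun x => f (x, w)) (Iic (-1)) u := fun hf w hw =>
    (hf.comp (by fun_prop : ContinuousOn (fun x : ℝ => (x, w)) (Iic (-1)))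
      fun x hx => ⟨hx, hw⟩) u huv.1
  have hrw := hslice hr.smooth.continuousOn
  have hαw := hslice hα.continuousOn
  have hsub : Iio u ⊆ Iic (-1) := fun x hx => (le_of_lt hx).trans huv.1
  have hL : ContinuousWithinAt
      (fun x => |(r x v) ^ 5 * α x v - (r x 1) ^ 5 * α x 1|) (Iio u) u :=
    (((((hrw v hv).pow 5).mul (hαw v hv)).sub
      (((hrw 1 le_rfl).pow 5).mul (hαw 1 le_rfl))).abs).mono hsub
  have hR : ContinuousWithinAt
      (fun x => 120 / ((1 + p) * (4 - p)) * K * M * (r x v) ^ (4 - p)) (Iio u) u :=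
    (continuousWithinAt_const.mul ((hrw v hv).rpow_const (Or.inr h4p.le))).mono hsub
  refine le_of_tendsto_of_tendsto hL hR ?_
  filter_upwards [self_mem_nhdsWithin] with x hx
  exact bootstrap_improvement_of_lt hp0 hp4 hM hM8 hr hα heq hK hlim
    (lt_of_lt_of_le hx huv.1) hv
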